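/- Let k ≥ 3 and let f₁, f₂ be multisets on 𝔽₂^{k−1} with distinguishing number k (i.e., they are (k−1)-indistinguishable but k-distinguishable). Then there exists a bijective 𝔽₂-linear map θ : 𝔽₂^{k−1} → 𝔽₂^{k−1} such that the image multisets θf₁ and θf₂ are in standard position, i.e., (θf₁)^(e₁)⋯(θf₁)^(e_{k−1})·(θf₁)^(h) ≠ (θf₂)^(e₁)⋯(θf₂)^(e_{k−1})·(θf₂)^(h), where h = e₁ + ⋯ + e_{k−1}. -/

import Mathlib

open Finset

/-- The `k`-deck of a multiset `φ : G → ℕ`. -/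
def deck {G : Type*} [Fintype G] [AddCommGroup G] (k : ℕ) (φ : G → ℕ) :
    (Fin k → G) → ℕ :=
  fun s => ∑ g : G, ∏ i, φ (g + s i)

/-- `φ` and `ψ` are `k`-indistinguishable if their `i`-decks agree for all `i ≤ k`. -/
def Indist {G : Type*} [Fintype G] [AddCommGroup G] (k : ℕ) (φ ψ : G → ℕ) : Prop :=
  ∀ i, i ≤ k → deck i φ = deck i ψ

/-- The character pairing `⟨x,y⟩ = (−1)^(∑ xᵢyᵢ) ∈ ℤ` on `𝔽₂^n`. -/
def chr {n : ℕ} (x y : Fin n → ZMod 2) : ℤ :=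
  (-1 : ℤ) ^ (∑ i, x i * y i).val

/-- The Fourier transform of a multiset `φ : 𝔽₂^n → ℕ`, viewed as taking values in `ℤ`. -/
def ftN {n : ℕ} (φ : (Fin n → ZMod 2) → ℕ) : (Fin n → ZMod 2) → ℤ :=
  fun x => ∑ y, (φ y : ℤ) * chr x y

/-- The image multiset `θφ(x) = ∑_{z : θz = x} φ(z)` of `φ` under a linear map `θ`. -/
def pushN {n p : ℕ} (θ : (Fin n → ZMod 2) →ₗ[ZMod 2] (Fin p → ZMod 2))
    (φ : (Fin n → ZMod 2) → ℕ) : (Fin p → ZMod 2) → ℕ :=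
  fun x => ∑ z ∈ Finset.univ.filter (fun z => θ z = x), φ z

theorem neg_one_pow_val_add (a b : ZMod 2) :
    (-1 : ℤ) ^ (a + b).val = (-1) ^ a.val * (-1) ^ b.val := by
  revert a b
  decide

theorem chr_comm {n : ℕ} (x y : Fin n → ZMod 2) : chr x y = chr y x := by
  simp only [chr, mul_comm]

theorem chr_add_right {n : ℕ} (x y z : Fin n → ZMod 2) :
    chr x (y + z) = chr x y * chr x z := by
  simp only [chr, Pi.add_apply, mul_add, Finset.sum_add_distrib, neg_one_pow_val_add]

theorem chr_add_left {n : ℕ} (x y z : Fin n → ZMod 2) :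
    chr (x + y) z = chr x z * chr y z := by
  rw [chr_comm, chr_add_right, chr_comm z, chr_comm z]

theorem chr_zero_left {n : ℕ} (z : Fin n → ZMod 2) : chr 0 z = 1 := by
  simp [chr]

theorem chr_sum_left {n : ℕ} {ι : Type*} (s : Finset ι) (x : ι → Fin n → ZMod 2)
    (z : Fin n → ZMod 2) : chr (∑ i ∈ s, x i) z = ∏ i ∈ s, chr (x i) z := by
  classical
  induction s using Finset.induction_on with
  | empty => simp [chr_zero_left]
  | insert a s ha ih => rw [Finset.sum_insert ha, Finset.prod_insert ha, chr_add_left, ih]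

theorem chr_single_left {n : ℕ} (i : Fin n) (y : Fin n → ZMod 2) :
    chr (Pi.single i 1) y = (-1) ^ (y i).val := by
  simp [chr, Pi.single_apply]

/-- Orthogonality of characters of `𝔽₂^n`. -/
theorem sum_chr {n : ℕ} (y : Fin n → ZMod 2) :
    ∑ x, chr x y = if y = 0 then (Fintype.card (Fin n → ZMod 2) : ℤ) else 0 := by
  split_ifs with h
  · simp [h, chr_comm _ 0, chr_zero_left]
  · obtain ⟨i, hi⟩ := Function.ne_iff.mp h
    have hi1 : y i = 1 := by
      have : ∀ a : ZMod 2, a ≠ 0 → a = 1 := by decide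
      exact this _ hi
    have hc : chr (Pi.single i 1) y = -1 := by
      rw [chr_single_left, hi1]
      rfl
    have hs := Equiv.sum_comp (Equiv.addLeft (Pi.single i 1 : Fin n → ZMod 2)) (chr · y)
    simp only [Equiv.coe_addLeft, chr_add_left, hc, ← Finset.mul_sum] at hs
    linarith

theorem add_self_zmod_two {n : ℕ} (x : Fin n → ZMod 2) : x + x = 0 := by
  have : ∀ a : ZMod 2, a + a = 0 := by decide
  exact funext fun i => this _

theorem add_eq_zero_iff_eq_zmod_two {n : ℕ} (x y : Fin n → ZMod 2) : x + y = 0 ↔ x = y := by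
  constructor
  · intro h
    have h2 : x + y = y + y := by rw [h, add_self_zmod_two]
    exact add_right_cancel h2
  · rintro rfl
    exact add_self_zmod_two x

theorem sum_translate_mul_chr {n : ℕ} (φ : (Fin n → ZMod 2) → ℕ) (g x : Fin n → ZMod 2) :
    ∑ s, (φ (g + s) : ℤ) * chr x s = chr x g * ftN φ x := by
  rw [← Equiv.sum_comp (Equiv.addLeft g)]
  simp only [Equiv.coe_addLeft, ← add_assoc, add_self_zmod_two, zero_add, chr_add_right, ftN,
    Finset.mul_sum]
  exact Finset.sum_congr rfl fun s _ => by ring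

/-- The Fourier transform of the `k`-deck. -/
theorem sum_deck_mul_chr {n k : ℕ} (φ : (Fin n → ZMod 2) → ℕ) (x : Fin k → Fin n → ZMod 2) :
    ∑ s : Fin k → Fin n → ZMod 2, (deck k φ s : ℤ) * ∏ j, chr (x j) (s j) =
      (if ∑ j, x j = 0 then (Fintype.card (Fin n → ZMod 2) : ℤ) else 0) * ∏ j, ftN φ (x j) := by
  simp only [deck, Nat.cast_sum, Nat.cast_prod, Finset.sum_mul, ← Finset.prod_mul_distrib]
  rw [Finset.sum_comm, ← sum_chr]
  simp only [chr_comm _ (∑ j, x j), chr_sum_left, Finset.sum_mul, ← Finset.prod_mul_distrib]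
  refine Finset.sum_congr rfl fun g _ => ?_
  rw [← Fintype.prod_sum (fun j (t : Fin n → ZMod 2) => (φ (g + t) : ℤ) * chr (x j) t)]
  exact Finset.prod_congr rfl fun j _ => sum_translate_mul_chr φ g (x j)

theorem prod_ftN_eq_of_deck_eq {n k : ℕ} {φ ψ : (Fin n → ZMod 2) → ℕ}
    (h : deck k φ = deck k ψ) (x : Fin k → Fin n → ZMod 2) (hx : ∑ j, x j = 0) :
    ∏ j, ftN φ (x j) = ∏ j, ftN ψ (x j) := by
  have h1 := sum_deck_mul_chr φ x
  rw [h, sum_deck_mul_chr ψ x, if_pos hx] at h1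
  exact (mul_left_cancel₀ (by exact_mod_cast Fintype.card_ne_zero) h1).symm

theorem sum_fourier_inversion {n k : ℕ} (D : (Fin k → Fin n → ZMod 2) → ℤ)
    (t : Fin k → Fin n → ZMod 2) :
    ∑ x : Fin k → Fin n → ZMod 2,
        (∑ s : Fin k → Fin n → ZMod 2, D s * ∏ j, chr (x j) (s j)) * ∏ j, chr (x j) (t j) =
      (Fintype.card (Fin n → ZMod 2) : ℤ) ^ k * D t := by
  simp only [Finset.sum_mul, mul_assoc, ← Finset.prod_mul_distrib, ← chr_add_right]
  rw [Finset.sum_comm]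
  simp only [← Finset.mul_sum]
  have key : ∀ s : Fin k → Fin n → ZMod 2,
      ∑ x : Fin k → Fin n → ZMod 2, ∏ j, chr (x j) (s j + t j) =
        if s = t then (Fintype.card (Fin n → ZMod 2) : ℤ) ^ k else 0 := by
    intro s
    rw [← Fintype.prod_sum (fun j (u : Fin n → ZMod 2) => chr u (s j + t j))]
    simp only [sum_chr, add_eq_zero_iff_eq_zmod_two]
    split_ifs with h
    · simp [h]
    · obtain ⟨j, hj⟩ := Function.ne_iff.mp h
      exact Finset.prod_eq_zero (Finset.mem_univ j) (if_neg hj)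
  simp [key, mul_comm]

theorem deck_eq_of_prod_ftN_eq {n k : ℕ} {φ ψ : (Fin n → ZMod 2) → ℕ}
    (h : ∀ x : Fin k → Fin n → ZMod 2, ∑ j, x j = 0 →
      ∏ j, ftN φ (x j) = ∏ j, ftN ψ (x j)) : deck k φ = deck k ψ := by
  funext t
  have h1 := sum_fourier_inversion (fun s => (deck k φ s : ℤ)) t
  have h2 := sum_fourier_inversion (fun s => (deck k ψ s : ℤ)) t
  have h3 : ∀ x : Fin k → Fin n → ZMod 2,
      ∑ s : Fin k → Fin n → ZMod 2, (deck k φ s : ℤ) * ∏ j, chr (x j) (s j) =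
        ∑ s : Fin k → Fin n → ZMod 2, (deck k ψ s : ℤ) * ∏ j, chr (x j) (s j) := by
    intro x
    rw [sum_deck_mul_chr, sum_deck_mul_chr]
    split_ifs with hx
    · rw [h x hx]
    · simp
  simp only [h3] at h1
  have h4 := h1.symm.trans h2
  have hc : (Fintype.card (Fin n → ZMod 2) : ℤ) ^ k ≠ 0 :=
    pow_ne_zero _ (by exact_mod_cast Fintype.card_ne_zero)
  exact_mod_cast mul_left_cancel₀ hc h4

theorem Indist.prod_ftN_eq {n m : ℕ} {φ ψ : (Fin n → ZMod 2) → ℕ} (h : Indist m φ ψ)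
    {ι : Type*} (T : Finset ι) (x : ι → Fin n → ZMod 2) (hT : #T ≤ m)
    (hx : ∑ i ∈ T, x i = 0) : ∏ i ∈ T, ftN φ (x i) = ∏ i ∈ T, ftN ψ (x i) := by
  have e := T.equivFin.symm
  have hsum : ∑ j, x (e j) = 0 := by
    rw [Equiv.sum_comp e (fun i : T => x i), Finset.sum_coe_sort T x, hx]
  have hp := prod_ftN_eq_of_deck_eq (h _ hT) (fun j => x (e j)) hsum
  rwa [Equiv.prod_comp e (fun i : T => ftN φ (x i)), Equiv.prod_comp e (fun i : T => ftN ψ (x i)),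
    Finset.prod_coe_sort T (fun i => ftN φ (x i)),
    Finset.prod_coe_sort T (fun i => ftN ψ (x i))] at hp

theorem ftN_pushN {n p : ℕ} (θ : (Fin n → ZMod 2) →ₗ[ZMod 2] (Fin p → ZMod 2))
    (φ : (Fin n → ZMod 2) → ℕ) (w : Fin p → ZMod 2) :
    ftN (pushN θ φ) w = ∑ z, (φ z : ℤ) * chr w (θ z) := by
  simp only [ftN, pushN, Nat.cast_sum, Finset.sum_mul]
  rw [← Finset.sum_fiberwise Finset.univ θ]
  refine Finset.sum_congr rfl fun y _ => Finset.sum_congr rfl fun z hz => ?_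
  rw [(Finset.mem_filter.mp hz).2]

theorem chr_mulVec {n p : ℕ} (A : Matrix (Fin p) (Fin n) (ZMod 2)) (w : Fin p → ZMod 2)
    (z : Fin n → ZMod 2) : chr w (A.mulVec z) = chr (A.vecMul w) z := by
  change (-1 : ℤ) ^ (w ⬝ᵥ A.mulVec z).val = (-1 : ℤ) ^ (A.vecMul w ⬝ᵥ z).val
  rw [Matrix.dotProduct_mulVec]

theorem ftN_pushN_mulVecLin {n p : ℕ} (A : Matrix (Fin p) (Fin n) (ZMod 2))
    (φ : (Fin n → ZMod 2) → ℕ) (w : Fin p → ZMod 2) :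
    ftN (pushN A.mulVecLin φ) w = ftN φ (A.vecMul w) := by
  simp only [ftN_pushN, Matrix.mulVecLin_apply, chr_mulVec]
  rfl

/-- Over `𝔽₂`, a family all of whose nonempty subfamilies have nonzero sum is linearly
independent. -/
theorem linearIndependent_of_sum_ne_zero {n : ℕ} {ι : Type*} [Fintype ι]
    {x : ι → Fin n → ZMod 2} (h : ∀ T : Finset ι, T.Nonempty → ∑ i ∈ T, x i ≠ 0) :
    LinearIndependent (ZMod 2) x := by
  rw [Fintype.linearIndependent_iff]
  intro c hc i
  by_contra hi
  refine h (Finset.univ.filter fun i => c i ≠ 0) ⟨i, by simpa using hi⟩ ?_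
  refine Eq.trans ?_ hc
  rw [Finset.sum_filter]
  refine Finset.sum_congr rfl fun j _ => ?_
  have h01 : ∀ a : ZMod 2, a ≠ 0 → a = 1 := by decide
  split_ifs with hj
  · rw [h01 _ hj, one_smul]
  · rw [not_not.mp hj, zero_smul]

theorem exists_standard_position {n : ℕ} {f₁ f₂ : (Fin n → ZMod 2) → ℕ}
    (hindist : Indist n f₁ f₂) (hdist : ¬ Indist (n + 1) f₁ f₂) :
    ∃ θ : (Fin n → ZMod 2) →ₗ[ZMod 2] (Fin n → ZMod 2),
      Function.Bijective θ ∧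
      (∏ i, ftN (pushN θ f₁) (Pi.single i 1)) * ftN (pushN θ f₁) (fun _ => 1) ≠
      (∏ i, ftN (pushN θ f₂) (Pi.single i 1)) * ftN (pushN θ f₂) (fun _ => 1) := by
  have hdeck : deck (n + 1) f₁ ≠ deck (n + 1) f₂ := by
    intro h
    refine hdist fun i hi => ?_
    rcases Nat.le_succ_iff.mp hi with hi | rfl
    exacts [hindist i hi, h]
  obtain ⟨x, hx, hne⟩ : ∃ x : Fin (n + 1) → Fin n → ZMod 2, ∑ j, x j = 0 ∧
      ∏ j, ftN f₁ (x j) ≠ ∏ j, ftN f₂ (x j) := by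
    by_contra! h
    exact hdeck (deck_eq_of_prod_ftN_eq h)
  have hlast : ∑ i : Fin n, x i.castSucc = x (Fin.last n) := by
    rwa [Fin.sum_univ_castSucc, add_eq_zero_iff_eq_zmod_two] at hx
  have hli : LinearIndependent (ZMod 2) fun i : Fin n => x i.castSucc := by
    refine linearIndependent_of_sum_ne_zero fun T hT hsum => hne ?_
    set S := T.map Fin.castSuccEmb with hS
    have hS0 : ∑ i ∈ S, x i = 0 := by rw [hS, Finset.sum_map]; exact hsum
    have hS0' : ∑ i ∈ Sᶜ, x i = 0 := by
      rw [← Finset.sum_add_sum_compl S, hS0, zero_add] at hx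
      exact hx
    have hcard : #S ≤ n := by
      simpa [hS] using Finset.card_le_univ T
    have hcard' : #Sᶜ ≤ n := by
      have := hT.card_pos
      rw [Finset.card_compl, Fintype.card_fin, hS, Finset.card_map]
      omega
    rw [← Finset.prod_mul_prod_compl S, ← Finset.prod_mul_prod_compl S (fun j => ftN f₂ (x j)),
      hindist.prod_ftN_eq S x hcard hS0, hindist.prod_ftN_eq Sᶜ x hcard' hS0']
  let A : Matrix (Fin n) (Fin n) (ZMod 2) := Matrix.of fun i => x i.castSucc
  have hA : IsUnit A := Matrix.linearIndependent_rows_iff_isUnit.mp hli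
  have hones : A.vecMul (fun _ => 1) = x (Fin.last n) := by
    rw [← hlast]
    ext j
    simp [Matrix.vecMul, dotProduct, A]
  have hsingle : ∀ i, A.vecMul (Pi.single i 1) = x i.castSucc := fun i => by
    rw [Matrix.single_one_vecMul]
    rfl
  refine ⟨A.mulVecLin, Finite.injective_iff_bijective.mp
    (Matrix.mulVec_injective_iff_isUnit.mpr hA), ?_⟩
  simp only [ftN_pushN_mulVecLin, hones, hsingle]
  rwa [Fin.prod_univ_castSucc, Fin.prod_univ_castSucc] at hne

/-- For `k ≥ 3`, if multisets `f₁`, `f₂` on `𝔽₂^(k-1)` have distinguishing number `k`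
(i.e. they are `(k-1)`-indistinguishable but `k`-distinguishable), then there is a
bijective `𝔽₂`-linear map `θ` of `𝔽₂^(k-1)` such that `θf₁` and `θf₂` are in standard
position: `(θf₁)^(e₁)⋯(θf₁)^(e_{k-1})·(θf₁)^(h) ≠ (θf₂)^(e₁)⋯(θf₂)^(e_{k-1})·(θf₂)^(h)`
where `h = e₁ + ⋯ + e_{k-1}` is the all-ones vector. -/
theorem stmt12 (k : ℕ) (hk : 3 ≤ k) (f₁ f₂ : (Fin (k - 1) → ZMod 2) → ℕ)
    (hindist : Indist (k - 1) f₁ f₂) (hdist : ¬ Indist k f₁ f₂) :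
    ∃ θ : (Fin (k - 1) → ZMod 2) →ₗ[ZMod 2] (Fin (k - 1) → ZMod 2),
      Function.Bijective θ ∧
      (∏ i, ftN (pushN θ f₁) (Pi.single i 1)) * ftN (pushN θ f₁) (fun _ => 1) ≠
      (∏ i, ftN (pushN θ f₂) (Pi.single i 1)) * ftN (pushN θ f₂) (fun _ => 1) := by
  obtain ⟨n, rfl⟩ : ∃ n, k = n + 1 := ⟨k - 1, by omega⟩
  exact exists_standard_position hindist hdist
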